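/- A locally symmetric Riemannian manifold whose Ricci tensor vanishes identically is flat, i.e. its full Riemann curvature tensor vanishes. -/

import Mathlib

/-!
Core framework: coordinate tensor calculus on `ℝⁿ` (partial derivatives, Christoffel
symbols, Riemann curvature, iterated covariant derivatives `∇ʳR`), and a notion of
pseudo-Riemannian manifold given by an atlas of metric charts whose transition
functions are smooth isometries.
-/

noncomputable section

open Matrix Set

/-- Partial derivative in the `i`-th coordinate direction. -/
def pd {n : ℕ} (i : Fin n) (f : (Fin n → ℝ) → ℝ) (x : Fin n → ℝ) : ℝ :=
  fderiv ℝ f x (Pi.single i 1)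

/-- A metric in coordinates: a matrix-valued function on (an open subset of) `ℝⁿ`. -/
abbrev MetricMat (n : ℕ) := (Fin n → ℝ) → Matrix (Fin n) (Fin n) ℝ

/-- Christoffel symbols `Γ^k_{ij}` of a coordinate metric. -/
def christoffel {n : ℕ} (g : MetricMat n) (x : Fin n → ℝ) (k i j : Fin n) : ℝ :=
  (1 / 2) * ∑ l, (g x)⁻¹ k l *
    (pd i (fun y => g y l j) x + pd j (fun y => g y l i) x - pd l (fun y => g y i j) x)

/-- Curvature tensor `R^l_{kij}` (1,3) of a coordinate metric. -/
def curvUp {n : ℕ} (g : MetricMat n) (x : Fin n → ℝ) (l k i j : Fin n) : ℝ :=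
  pd i (fun y => christoffel g y l j k) x - pd j (fun y => christoffel g y l i k) x
    + ∑ m, christoffel g x l i m * christoffel g x m j k
    - ∑ m, christoffel g x l j m * christoffel g x m i k

/-- Covariant tensor fields of valence `s` in coordinates. -/
abbrev TensorField (n s : ℕ) := (Fin n → ℝ) → (Fin s → Fin n) → ℝ

/-- The (0,4) Riemann curvature tensor `R_{lkij} = g_{lm} R^m_{kij}`. -/
def riemann {n : ℕ} (g : MetricMat n) : TensorField n 4 := fun x idx =>
  ∑ m, g x (idx 0) m * curvUp g x m (idx 1) (idx 2) (idx 3)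

/-- The Ricci tensor `R_{ij} = R^m_{imj}`. -/
def ricci {n : ℕ} (g : MetricMat n) (x : Fin n → ℝ) (i j : Fin n) : ℝ :=
  ∑ m, curvUp g x m i m j

/-- Covariant derivative of a covariant tensor field; the new (derivative) index is slot `0`. -/
def covDeriv {n s : ℕ} (g : MetricMat n) (T : TensorField n s) : TensorField n (s + 1) :=
  fun x idx =>
    pd (idx 0) (fun y => T y fun a => idx a.succ) x
      - ∑ a : Fin s, ∑ e, christoffel g x e (idx 0) (idx a.succ)
          * T x (Function.update (fun b : Fin s => idx b.succ) a e)

/-- Iterated covariant derivative `∇ʳ R` of the curvature tensor. -/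
def nablaR {n : ℕ} (g : MetricMat n) : (r : ℕ) → TensorField n (4 + r)
  | 0 => riemann g
  | r + 1 => covDeriv g (nablaR g r)

/-- `∇ʳ R = 0` on `U` (`r`-th symmetry in coordinates). -/
def RthSymmetricOn {n : ℕ} (g : MetricMat n) (U : Set (Fin n → ℝ)) (r : ℕ) : Prop :=
  ∀ x ∈ U, ∀ idx, nablaR g r x idx = 0

/-- Vanishing curvature (flatness) on `U`. -/
def FlatOn {n : ℕ} (g : MetricMat n) (U : Set (Fin n → ℝ)) : Prop :=
  ∀ x ∈ U, ∀ idx, riemann g x idx = 0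

/-- A symmetric matrix is of Lorentzian signature `(-,+,…,+)` iff it is congruent to
`diag(-1,1,…,1)`. -/
def IsLorentzMat {n : ℕ} (A : Matrix (Fin n) (Fin n) ℝ) : Prop :=
  ∃ P : Matrix (Fin n) (Fin n) ℝ, IsUnit P.det ∧
    Pᵀ * A * P = Matrix.diagonal fun i : Fin n => if (i : ℕ) = 0 then (-1 : ℝ) else 1

/-- `τ` is smooth on `S` and pulls the metric `g₂` back to the metric `g₁` there. -/
def IsPullbackIsometry {n m : ℕ} (g₁ : MetricMat n) (g₂ : MetricMat m)
    (τ : (Fin n → ℝ) → Fin m → ℝ) (S : Set (Fin n → ℝ)) : Prop :=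
  (∀ a : Fin m, ContDiffOn ℝ (⊤ : ℕ∞) (fun y => τ y a) S) ∧
  ∀ x ∈ S, ∀ i j : Fin n,
    g₁ x i j = ∑ a, ∑ b, g₂ (τ x) a b * pd i (fun y => τ y a) x * pd j (fun y => τ y b) x

/-- A metric chart on a topological space `M`: a homeomorphism of an open set of `M` onto
an open set of `ℝⁿ`, together with the coordinate expression of the metric tensor. -/
structure MetricChart (n : ℕ) (M : Type) [TopologicalSpace M] where
  dom : Set M
  open_dom : IsOpen dom
  φ : M → Fin n → ℝ
  ψ : (Fin n → ℝ) → M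
  ran : Set (Fin n → ℝ)
  open_ran : IsOpen ran
  maps_to : ∀ p ∈ dom, φ p ∈ ran
  maps_from : ∀ x ∈ ran, ψ x ∈ dom
  left_inv : ∀ p ∈ dom, ψ (φ p) = p
  right_inv : ∀ x ∈ ran, φ (ψ x) = x
  cont_phi : ContinuousOn φ dom
  cont_psi : ContinuousOn ψ ran
  g : MetricMat n
  smooth_g : ∀ a b : Fin n, ContDiffOn ℝ (⊤ : ℕ∞) (fun x => g x a b) ran
  symm_g : ∀ x ∈ ran, (g x).IsSymm
  nondeg_g : ∀ x ∈ ran, IsUnit (g x).det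

/-- An `n`-dimensional pseudo-Riemannian manifold: a topological space covered by metric
charts whose transition functions are (smooth) isometries for the chart metrics. -/
structure PRManifold (n : ℕ) where
  M : Type
  top : TopologicalSpace M
  chartAt : M → @MetricChart n M top
  mem_chart : ∀ p : M, p ∈ (chartAt p).dom
  compatible : ∀ p q : M,
    IsPullbackIsometry (chartAt p).g (chartAt q).g ((chartAt q).φ ∘ (chartAt p).ψ)
      ((chartAt p).φ '' ((chartAt p).dom ∩ (chartAt q).dom))

attribute [instance] PRManifold.top

namespace PRManifold

variable {n : ℕ}

/-- The metric is Lorentzian, of signature `(-,+,…,+)`. -/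
def IsLorentzian (X : PRManifold n) : Prop :=
  ∀ p : X.M, ∀ x ∈ (X.chartAt p).ran, IsLorentzMat ((X.chartAt p).g x)

/-- The metric is Riemannian (positive definite). -/
def IsRiemannian (X : PRManifold n) : Prop :=
  ∀ p : X.M, ∀ x ∈ (X.chartAt p).ran, ((X.chartAt p).g x).PosDef

/-- Connectedness of the underlying space. -/
def Conn (X : PRManifold n) : Prop := ConnectedSpace X.M

/-- Simple connectedness of the underlying space. -/
def SimplyConn (X : PRManifold n) : Prop := SimplyConnectedSpace X.M

/-- `∇ʳ R = 0` (in every chart). -/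
def RthSymmetric (X : PRManifold n) (r : ℕ) : Prop :=
  ∀ p : X.M, RthSymmetricOn (X.chartAt p).g (X.chartAt p).ran r

/-- `∇ʳ R = 0` but `∇^{r-1} R ≠ 0`. -/
def ProperRthSymmetric (X : PRManifold n) (r : ℕ) : Prop :=
  X.RthSymmetric r ∧ ¬ X.RthSymmetric (r - 1)

/-- The curvature tensor vanishes identically. -/
def Flat (X : PRManifold n) : Prop :=
  ∀ p : X.M, FlatOn (X.chartAt p).g (X.chartAt p).ran

/-- The Ricci tensor vanishes identically. -/
def RicciFlat (X : PRManifold n) : Prop :=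
  ∀ p : X.M, ∀ x ∈ (X.chartAt p).ran, ∀ i j, ricci (X.chartAt p).g x i j = 0

end PRManifold

/-- A curve `c` (written in coordinates) is a geodesic of `g` on the parameter set `I`:
its components are twice differentiable and satisfy the geodesic equations. -/
def IsGeodesicCurve {n : ℕ} (g : MetricMat n) (I : Set ℝ) (c : ℝ → Fin n → ℝ) : Prop :=
  ∀ t ∈ I, ∀ k : Fin n,
    DifferentiableAt ℝ (fun s => c s k) t ∧
    DifferentiableAt ℝ (deriv fun s => c s k) t ∧
    deriv (deriv fun s => c s k) t
      + ∑ i, ∑ j, christoffel g (c t) k i j * deriv (fun s => c s i) t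
          * deriv (fun s => c s j) t = 0

namespace PRManifold

variable {n : ℕ}

/-- `γ` is a geodesic of `X` on the parameter set `I`: around each parameter it lies in a
chart and its coordinate expression solves the geodesic equations there. -/
def IsGeodesic (X : PRManifold n) (I : Set ℝ) (γ : ℝ → X.M) : Prop :=
  ∀ t ∈ I, ∃ p : X.M, ∃ ε > (0 : ℝ),
    (∀ s ∈ I ∩ Set.Ioo (t - ε) (t + ε), γ s ∈ (X.chartAt p).dom) ∧
    IsGeodesicCurve (X.chartAt p).g (I ∩ Set.Ioo (t - ε) (t + ε))
      (fun s => (X.chartAt p).φ (γ s))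

/-- Geodesic completeness: every (nontrivial) geodesic defined on an open interval
extends to a geodesic defined on all of `ℝ`. -/
def GeodesicallyComplete (X : PRManifold n) : Prop :=
  ∀ (a b : ℝ) (γ : ℝ → X.M), (Set.Ioo a b).Nonempty → X.IsGeodesic (Set.Ioo a b) γ →
    ∃ γ' : ℝ → X.M, X.IsGeodesic Set.univ γ' ∧ ∀ t ∈ Set.Ioo a b, γ' t = γ t

end PRManifold

/-- First block of coordinates of a product. -/
def split1 {n₁ n₂ : ℕ} (x : Fin (n₁ + n₂) → ℝ) : Fin n₁ → ℝ := fun i => x (Fin.castAdd n₂ i)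

/-- Second block of coordinates of a product. -/
def split2 {n₁ n₂ : ℕ} (x : Fin (n₁ + n₂) → ℝ) : Fin n₂ → ℝ := fun j => x (Fin.natAdd n₁ j)

/-- The direct-product (block diagonal) metric `g₁ ⊕ g₂` in coordinates. -/
def prodMetricMat {n₁ n₂ : ℕ} (G₁ : MetricMat n₁) (G₂ : MetricMat n₂) :
    MetricMat (n₁ + n₂) := fun x =>
  (Matrix.fromBlocks (G₁ (split1 x)) 0 0 (G₂ (split2 x))).submatrix
    finSumFinEquiv.symm finSumFinEquiv.symm

/-- The (generalized Cahen–Wallach / plane-wave) metric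
`g = -2du(dv + P_{ij}(u)xⁱxʲ du) + δ_{ij} dxⁱ dxʲ` on `ℝ^{e+2}`,
with coordinates `x 0 = u`, `x 1 = v` and spatial coordinates `x i.succ.succ`. -/
def cwMetric (e : ℕ) (P : ℝ → Matrix (Fin e) (Fin e) ℝ) : MetricMat (e + 2) := fun x k l =>
  (if k = 0 ∧ l = 0 then (-2) * ∑ i, ∑ j, P (x 0) i j * x i.succ.succ * x j.succ.succ else 0)
  + (if (k = 0 ∧ l = 1) ∨ (k = 1 ∧ l = 0) then -1 else 0)
  + (if k = l ∧ 2 ≤ (k : ℕ) then 1 else 0)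

/-- The Brinkmann metric `ds² = -2du(dv + H du + Wᵢ dxⁱ) + g_{ij} dxⁱ dxʲ` on `ℝ^{d+2}`,
with coordinates `x 0 = u`, `x 1 = v` and spatial coordinates `x i.succ.succ`. -/
def brinkmannMat (d : ℕ) (H : (Fin (d + 2) → ℝ) → ℝ) (W : Fin d → (Fin (d + 2) → ℝ) → ℝ)
    (gs : (Fin (d + 2) → ℝ) → Matrix (Fin d) (Fin d) ℝ) : MetricMat (d + 2) := fun x k l =>
  (if k = 0 ∧ l = 0 then (-2) * H x else 0)
  + (if (k = 0 ∧ l = 1) ∨ (k = 1 ∧ l = 0) then -1 else 0)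
  + (if k = 0 then ∑ i : Fin d, if l = i.succ.succ then -(W i x) else 0 else 0)
  + (if l = 0 then ∑ i : Fin d, if k = i.succ.succ then -(W i x) else 0 else 0)
  + ∑ i : Fin d, ∑ j : Fin d, if k = i.succ.succ ∧ l = j.succ.succ then gs x i j else 0

/-- A function on `ℝ^{d+2}` is independent of the coordinate `v = x 1`. -/
def vIndep {d : ℕ} {α : Type*} (f : (Fin (d + 2) → ℝ) → α) : Prop :=
  ∀ x t, f (Function.update x (1 : Fin (d + 2)) t) = f x

/-- The point of `ℝ^{d+2}` with `u`, `v` and spatial coordinates `u`, `v`, `y`. -/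
def emb (d : ℕ) (u v : ℝ) (y : Fin d → ℝ) : Fin (d + 2) → ℝ :=
  Fin.cons u (Fin.cons v y)
-- extension layer (appended to core for testing)
namespace PRManifold

variable {n : ℕ}

/-- A self-map of `Y` is a (global) isometry: it is a homeomorphism and, read in the
charts, it pulls the metric back to the metric. -/
def IsAutoIsometry (Y : PRManifold n) (σ : Y.M → Y.M) : Prop :=
  Function.Bijective σ ∧ Continuous σ ∧
    ∀ q : Y.M, ∃ S, IsOpen S ∧ (Y.chartAt q).φ q ∈ S ∧ S ⊆ (Y.chartAt q).ran ∧
      (∀ x ∈ S, σ ((Y.chartAt q).ψ x) ∈ (Y.chartAt (σ q)).dom) ∧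
      IsPullbackIsometry (Y.chartAt q).g (Y.chartAt (σ q)).g
        (fun x => (Y.chartAt (σ q)).φ (σ ((Y.chartAt q).ψ x))) S

/-- `Y` is a (globally) symmetric space: the geodesic symmetry at every point extends to
a global isometry, i.e. every point is an isolated fixed point of a global isometry whose
differential there is `-id` (in chart coordinates). -/
def IsSymmetricSpace (Y : PRManifold n) : Prop :=
  ∀ q : Y.M, ∃ σ : Y.M → Y.M, Y.IsAutoIsometry σ ∧ σ q = q ∧
    ∀ a i : Fin n,
      pd i (fun x => (Y.chartAt (σ q)).φ (σ ((Y.chartAt q).ψ x)) a) ((Y.chartAt q).φ q)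
        = -(if i = a then 1 else 0)

/-- The metric of `X` is real-analytic: around every point there are coordinates in which
the metric components are real-analytic functions. -/
def AnalyticMetric (X : PRManifold n) : Prop :=
  ∀ p : X.M, ∃ S, IsOpen S ∧ (X.chartAt p).φ p ∈ S ∧ S ⊆ (X.chartAt p).ran ∧
    ∃ (τ : (Fin n → ℝ) → Fin n → ℝ) (G : MetricMat n),
      Set.InjOn τ S ∧ (∀ a b : Fin n, AnalyticOnNhd ℝ (fun y => G y a b) (τ '' S)) ∧
      IsPullbackIsometry (X.chartAt p).g G τ S

end PRManifold

/-- `Z` is globally isometric to the direct product `X × Y` (with the product metric):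
there is a bijection which, read in charts, is an isometry onto the product. -/
def GloballyIsometricToProd {n₀ n₁ n₂ : ℕ} (Z : PRManifold n₀)
    (X : PRManifold n₁) (Y : PRManifold n₂) : Prop :=
  ∃ F : Z.M → X.M × Y.M, Function.Bijective F ∧
    ∀ p : Z.M, ∃ S, IsOpen S ∧ (Z.chartAt p).φ p ∈ S ∧ S ⊆ (Z.chartAt p).ran ∧
      (∀ x ∈ S, (F ((Z.chartAt p).ψ x)).1 ∈ (X.chartAt (F p).1).dom
        ∧ (F ((Z.chartAt p).ψ x)).2 ∈ (Y.chartAt (F p).2).dom) ∧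
      IsPullbackIsometry (Z.chartAt p).g
        (prodMetricMat (X.chartAt (F p).1).g (Y.chartAt (F p).2).g)
        (fun x => Fin.append ((X.chartAt (F p).1).φ (F ((Z.chartAt p).ψ x)).1)
          ((Y.chartAt (F p).2).φ (F ((Z.chartAt p).ψ x)).2)) S

/-- `X` is globally isometric to the direct product of the coordinate spacetime
`(ℝ^{e+2}, Gcw)` and `Y` (with the product metric). -/
def GloballyIsometricToCWProd {n e m : ℕ} (X : PRManifold n) (Gcw : MetricMat (e + 2))
    (Y : PRManifold m) : Prop :=
  ∃ F : X.M → (Fin (e + 2) → ℝ) × Y.M, Function.Bijective F ∧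
    ∀ p : X.M, ∃ S, IsOpen S ∧ (X.chartAt p).φ p ∈ S ∧ S ⊆ (X.chartAt p).ran ∧
      (∀ x ∈ S, (F ((X.chartAt p).ψ x)).2 ∈ (Y.chartAt (F p).2).dom) ∧
      IsPullbackIsometry (X.chartAt p).g (prodMetricMat Gcw (Y.chartAt (F p).2).g)
        (fun x => Fin.append (F ((X.chartAt p).ψ x)).1
          ((Y.chartAt (F p).2).φ (F ((X.chartAt p).ψ x)).2)) S

/-- `X` is locally isometric to the direct product of the coordinate spacetime
`(ℝ^{e+2}, Gcw)` and `Y`: every point has a neighbourhood that maps isometrically into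
the product. -/
def LocallyIsometricToCWProd {n e m : ℕ} (X : PRManifold n) (Gcw : MetricMat (e + 2))
    (Y : PRManifold m) : Prop :=
  ∀ p : X.M, ∃ q : Y.M, ∃ S, IsOpen S ∧ (X.chartAt p).φ p ∈ S ∧ S ⊆ (X.chartAt p).ran ∧
    ∃ τ : (Fin n → ℝ) → Fin ((e + 2) + m) → ℝ,
      (∀ x ∈ S, split2 (n₁ := e + 2) (τ x) ∈ (Y.chartAt q).ran) ∧
      IsPullbackIsometry (X.chartAt p).g (prodMetricMat Gcw (Y.chartAt q).g) τ S

/-- An identification of `Σ i, Fin (m i)` with `Fin (∑ i, m i)`. -/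
def sigmaFinEquiv {k : ℕ} (m : Fin k → ℕ) : (Σ i : Fin k, Fin (m i)) ≃ Fin (∑ i, m i) :=
  (Fintype.equivFin _).trans (finCongr (by simp))

/-- The `i`-th block of coordinates in `ℝ^{∑ mdim}`. -/
def sigCoord {k : ℕ} {mdim : Fin k → ℕ} (x : Fin (∑ i, mdim i) → ℝ) (i : Fin k) :
    Fin (mdim i) → ℝ := fun a => x (sigmaFinEquiv mdim ⟨i, a⟩)

/-- The block-diagonal metric of a finite direct product, in coordinates. -/
def multiBlockMetric {k : ℕ} {mdim : Fin k → ℕ}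
    (G : (i : Fin k) → MetricMat (mdim i)) : MetricMat (∑ i, mdim i) := fun x a b =>
  let sa := (sigmaFinEquiv mdim).symm a
  let sb := (sigmaFinEquiv mdim).symm b
  if h : sa.1 = sb.1 then G sb.1 (sigCoord x sb.1) (h ▸ sa.2) sb.2 else 0

/-- `X` is globally isometric to the direct product of the coordinate spacetime
`(ℝ^d, Gcw)` with the finite family of manifolds `Y i` (with the product metric). -/
def GloballyIsometricToCWMultiProd {n d k : ℕ} {mdim : Fin k → ℕ}
    (X : PRManifold n) (Gcw : MetricMat d)
    (Y : (i : Fin k) → PRManifold (mdim i)) : Prop :=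
  ∃ F : X.M → (Fin d → ℝ) × ((i : Fin k) → (Y i).M), Function.Bijective F ∧
    ∀ p : X.M, ∃ S, IsOpen S ∧ (X.chartAt p).φ p ∈ S ∧ S ⊆ (X.chartAt p).ran ∧
      (∀ x ∈ S, ∀ i, (F ((X.chartAt p).ψ x)).2 i ∈ ((Y i).chartAt ((F p).2 i)).dom) ∧
      IsPullbackIsometry (X.chartAt p).g
        (prodMetricMat Gcw (multiBlockMetric fun i => ((Y i).chartAt ((F p).2 i)).g))
        (fun x => Fin.append (F ((X.chartAt p).ψ x)).1
          (fun j => let s := (sigmaFinEquiv mdim).symm j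
            ((Y s.1).chartAt ((F p).2 s.1)).φ ((F ((X.chartAt p).ψ x)).2 s.1) s.2)) S

/-- `X` is locally isometric to the direct product of the coordinate spacetime
`(ℝ^d, Gcw)` with the finite family of manifolds `Y i`. -/
def LocallyIsometricToCWMultiProd {n d k : ℕ} {mdim : Fin k → ℕ}
    (X : PRManifold n) (Gcw : MetricMat d)
    (Y : (i : Fin k) → PRManifold (mdim i)) : Prop :=
  ∀ p : X.M, ∃ q : (i : Fin k) → (Y i).M, ∃ S, IsOpen S ∧ (X.chartAt p).φ p ∈ S ∧
    S ⊆ (X.chartAt p).ran ∧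
    ∃ τ : (Fin n → ℝ) → Fin (d + ∑ i, mdim i) → ℝ,
      (∀ x ∈ S, ∀ i : Fin k,
        sigCoord (split2 (n₁ := d) (τ x)) i ∈ ((Y i).chartAt (q i)).ran) ∧
      IsPullbackIsometry (X.chartAt p).g
        (prodMetricMat Gcw (multiBlockMetric fun i => ((Y i).chartAt (q i)).g)) τ S

/-- `X'` (with projection `π`) is a universal covering of `X`, with the pulled-back
metric: `π` is a topological covering map, `X'` is simply connected and `π` is a local
isometry. -/
def IsUniversalCoverOf {n : ℕ} (X' X : PRManifold n) (π : X'.M → X.M) : Prop :=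
  IsCoveringMap π ∧ X'.SimplyConn ∧
    ∀ p : X'.M, ∃ S, IsOpen S ∧ (X'.chartAt p).φ p ∈ S ∧ S ⊆ (X'.chartAt p).ran ∧
      (∀ x ∈ S, π ((X'.chartAt p).ψ x) ∈ (X.chartAt (π p)).dom) ∧
      IsPullbackIsometry (X'.chartAt p).g (X.chartAt (π p)).g
        (fun x => (X.chartAt (π p)).φ (π ((X'.chartAt p).ψ x))) S

/-- A skew endomorphism of a Euclidean space squares to an operator of nonpositive trace, and the
trace vanishes only for the zero endomorphism. -/
theorem trace_mul_self_of_skew {V : Type*} [AddCommGroup V] [Module ℝ V] [FiniteDimensional ℝ V]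
    (b : LinearMap.BilinForm ℝ V) (hsymm : b.IsSymm) (hpos : ∀ x, x ≠ 0 → 0 < b x x)
    (T : Module.End ℝ V) (hT : ∀ x y, b (T x) y = -b x (T y)) :
    LinearMap.trace ℝ V (T * T) ≤ 0 ∧ (LinearMap.trace ℝ V (T * T) = 0 → T = 0) := by
  classical
  obtain ⟨v, hv⟩ := LinearMap.BilinForm.exists_orthogonal_basis
    (LinearMap.BilinForm.isSymm_iff.mp hsymm)
  have hvpos : ∀ i, 0 < b (v i) (v i) := fun i => hpos _ (v.ne_zero i)
  have hnonneg : ∀ x, 0 ≤ b x x := fun x => by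
    by_cases hx : x = 0
    · simp [hx]
    · exact (hpos x hx).le
  have hcoeff : ∀ x i, b (v i) x = v.repr x i * b (v i) (v i) := by
    intro x i
    conv_lhs => rw [← v.sum_repr x]
    rw [map_sum, Finset.sum_eq_single i]
    · simp
    · intro j _ hj
      have : b (v i) (v j) = 0 := hv hj.symm
      simp [this]
    · simp
  have htr : LinearMap.trace ℝ V (T * T) = ∑ i, -(b (T (v i)) (T (v i)) / b (v i) (v i)) := by
    rw [LinearMap.trace_eq_matrix_trace ℝ v, Matrix.trace]
    refine Finset.sum_congr rfl fun i _ => ?_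
    rw [Matrix.diag_apply, LinearMap.toMatrix_apply, hT (v i), neg_div, neg_neg,
      eq_div_iff (hvpos i).ne', ← hcoeff]
    rfl
  have hterm : ∀ i, -(b (T (v i)) (T (v i)) / b (v i) (v i)) ≤ 0 := fun i =>
    neg_nonpos.mpr (div_nonneg (hnonneg _) (hvpos i).le)
  refine ⟨htr ▸ Finset.sum_nonpos fun i _ => hterm i, fun h0 => v.ext fun i => ?_⟩
  rw [htr, Finset.sum_eq_zero_iff_of_nonpos fun i _ => hterm i] at h0
  have h1 := h0 i (Finset.mem_univ i)
  rw [neg_eq_zero, div_eq_zero_iff, or_iff_left (hvpos i).ne'] at h1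
  by_contra hne
  exact (hpos _ hne).ne' h1

/-- An algebraic curvature operator on a Euclidean space that is annihilated by its own curvature
endomorphisms and has zero Ricci contraction vanishes. -/
theorem curvature_eq_zero_of_semisymmetric {V : Type*} [AddCommGroup V] [Module ℝ V]
    [FiniteDimensional ℝ V]
    (b : LinearMap.BilinForm ℝ V) (hsymm : b.IsSymm) (hpos : ∀ x, x ≠ 0 → 0 < b x x)
    (R : V →ₗ[ℝ] V →ₗ[ℝ] Module.End ℝ V)
    (hanti : ∀ x y, R x y = -R y x)
    (hskew : ∀ x y z w, b (R x y z) w = -b z (R x y w))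
    (hbianchi : ∀ x y z, R x y z + R y z x + R z x y = 0)
    (hsemi : ∀ x y u w, R x y * R u w - R u w * R x y = R (R x y u) w + R u (R x y w))
    (hric : ∀ x y, LinearMap.trace ℝ V ((R x).flip y) = 0) (x y : V) : R x y = 0 := by
  let h : Submodule ℝ (Module.End ℝ V) :=
    Submodule.span ℝ (Set.range fun p : V × V => R p.1 p.2)
  have hmem : ∀ u w, R u w ∈ h := fun u w => Submodule.subset_span ⟨(u, w), rfl⟩
  have hder : ∀ C ∈ h, ∀ u w, C * R u w - R u w * C = R (C u) w + R u (C w) := by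
    intro C hC u w
    induction hC using Submodule.span_induction with
    | mem C hC => obtain ⟨p, rfl⟩ := hC; exact hsemi _ _ _ _
    | zero => simp
    | add B C _ _ hB hC =>
      have : (B + C) * R u w - R u w * (B + C)
          = (B * R u w - R u w * B) + (C * R u w - R u w * C) := by noncomm_ring
      rw [this, hB, hC]; simp; abel
    | smul c C _ hC =>
      have : (c • C) * R u w - R u w * (c • C) = c • (C * R u w - R u w * C) := by
        simp [smul_sub]
      rw [this, hC]; simp
  have hskew' : ∀ C ∈ h, ∀ u w, b (C u) w = -b u (C w) := by
    intro C hC u w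
    induction hC using Submodule.span_induction with
    | mem C hC => obtain ⟨p, rfl⟩ := hC; exact hskew _ _ _ _
    | zero => simp
    | add B C _ _ hB hC => simp [hB, hC]; ring
    | smul c C _ hC => simp [hC]
  let ev : V → h →ₗ[ℝ] V := fun u => (LinearMap.applyₗ u).comp h.subtype
  let L : V → V →ₗ[ℝ] h := fun u => (R u).codRestrict h (hmem u)
  let A := R x y
  let ad : Module.End ℝ h := (L y).comp (ev x) - (L x).comp (ev y)
  have had : ∀ C : h, (ad C : Module.End ℝ V) = A * C - C * A := by
    intro C
    have h1 := hder C C.2 x y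
    have h2 : (ad C : Module.End ℝ V) = R y (C.1 x) - R x (C.1 y) := rfl
    rw [h2, hanti y, ← neg_sub (C.1 * R x y), h1]
    abel
  let bh : LinearMap.BilinForm ℝ h :=
    -((LinearMap.mul ℝ (Module.End ℝ V)).compr₂ (LinearMap.trace ℝ V)).compl₁₂ h.subtype h.subtype
  have hbh : ∀ B C : h, bh B C = -LinearMap.trace ℝ V (B.1 * C.1) := fun _ _ => rfl
  have hbsymm : bh.IsSymm := ⟨fun B C => by
    rw [hbh, hbh, LinearMap.trace_mul_comm]⟩
  have hbpos : ∀ C, C ≠ 0 → 0 < bh C C := by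
    intro C hC
    obtain ⟨h1, h2⟩ := trace_mul_self_of_skew b hsymm hpos C.1 (hskew' C C.2)
    rw [hbh, neg_pos]
    exact lt_of_le_of_ne h1 fun h0 => hC (Subtype.ext (h2 h0))
  have hadskew : ∀ B C, bh (ad B) C = -bh B (ad C) := by
    intro B C
    rw [hbh, hbh, had, had, neg_inj, sub_mul, mul_sub, map_sub, map_sub, mul_assoc,
      LinearMap.trace_mul_comm ℝ A, ← mul_assoc, ← mul_assoc]
    ring
  have hcyc : ∀ u w, LinearMap.trace ℝ h ((L u).comp (ev w)) = 0 := by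
    intro u w
    rw [LinearMap.trace_comp_comm', ← hric u w]
    rfl
  have hsq : ad * ad = ((L y).comp (A.comp (ev x)) - (L x).comp (A.comp (ev y)))
      - ((L y).comp (ev (A x)) - (L x).comp (ev (A y))) := by
    have hev : ∀ u, (ev u).comp ad = A.comp (ev u) - ev (A u) := by
      intro u
      ext C
      change (ad C : Module.End ℝ V) u = _
      rw [had]; rfl
    calc ad * ad = (L y).comp ((ev x).comp ad) - (L x).comp ((ev y).comp ad) := rfl
      _ = _ := by rw [hev, hev, LinearMap.comp_sub, LinearMap.comp_sub]; abel
  have hcomp : (A.comp (ev x)).comp (L y) - (A.comp (ev y)).comp (L x) = -(A * A) := by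
    ext w
    have := hbianchi x y w
    change A (R y w x) - A (R x w y) = -(A (A w))
    rw [← map_sub, ← map_neg]
    congr 1
    rw [hanti x w, LinearMap.neg_apply, sub_neg_eq_add, eq_neg_iff_add_eq_zero, ← this]
    change _ + R x y w = _
    abel
  have htr : LinearMap.trace ℝ h (ad * ad) = -LinearMap.trace ℝ V (A * A) := by
    rw [hsq, map_sub (LinearMap.trace ℝ h), map_sub (LinearMap.trace ℝ h),
      map_sub (LinearMap.trace ℝ h), hcyc, hcyc, LinearMap.trace_comp_comm' (A.comp (ev x)) (L y),
      LinearMap.trace_comp_comm' (A.comp (ev y)) (L x), ← map_sub (LinearMap.trace ℝ V), hcomp, map_neg]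
    ring
  have h1 := (trace_mul_self_of_skew bh hbsymm hbpos ad hadskew).1
  obtain ⟨h2, h3⟩ := trace_mul_self_of_skew b hsymm hpos A (hskew x y)
  exact h3 (by linarith)

section PartialDerivatives

variable {n : ℕ} {U : Set (Fin n → ℝ)} {x : Fin n → ℝ} {f f' : (Fin n → ℝ) → ℝ}

theorem pd_contDiffOn (hU : IsOpen U) (hf : ContDiffOn ℝ (⊤ : ℕ∞) f U) (i : Fin n) :
    ContDiffOn ℝ (⊤ : ℕ∞) (pd i f) U :=
  (hf.fderiv_of_isOpen hU (by simp)).clm_apply contDiffOn_const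

theorem differentiableAt_of_smoothOn (hU : IsOpen U) (hf : ContDiffOn ℝ (⊤ : ℕ∞) f U)
    (hx : x ∈ U) : DifferentiableAt ℝ f x :=
  (hf.differentiableOn (by simp)).differentiableAt (hU.mem_nhds hx)

theorem pd_congr_of_eqOn (hU : IsOpen U) (h : Set.EqOn f f' U) (hx : x ∈ U) (i : Fin n) :
    pd i f x = pd i f' x := by
  have : f =ᶠ[nhds x] f' := Filter.eventuallyEq_of_mem (hU.mem_nhds hx) h
  rw [pd, pd, this.fderiv_eq]

theorem pd_comm (hU : IsOpen U) (hf : ContDiffOn ℝ (⊤ : ℕ∞) f U) (hx : x ∈ U) (i j : Fin n) :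
    pd i (pd j f) x = pd j (pd i f) x := by
  have hd : DifferentiableAt ℝ (fderiv ℝ f) x :=
    ((hf.fderiv_of_isOpen (m := (⊤ : ℕ∞)) hU (by simp)).differentiableOn
      (by simp)).differentiableAt (hU.mem_nhds hx)
  have hpd : ∀ a b : Fin n, pd a (pd b f) x
      = fderiv ℝ (fderiv ℝ f) x (Pi.single a 1) (Pi.single b 1) := by
    intro a b
    have : pd b f = fun y => fderiv ℝ f y (Pi.single b 1) := rfl
    rw [pd, this, fderiv_clm_apply hd (differentiableAt_const _)]
    simp
  rw [hpd, hpd]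
  have hc : ContDiffAt ℝ (⊤ : ℕ∞) f x := hf.contDiffAt (hU.mem_nhds hx)
  exact (hc.isSymmSndFDerivAt (by rw [minSmoothness_of_isRCLikeNormedField]; exact WithTop.coe_le_coe.mpr le_top)).eq _ _

theorem pd_mul (hf : DifferentiableAt ℝ f x) (hf' : DifferentiableAt ℝ f' x) (i : Fin n) :
    pd i (fun y => f y * f' y) x = pd i f x * f' x + f x * pd i f' x := by
  rw [pd, fderiv_fun_mul hf hf']
  simp [pd]
  ring

theorem pd_sum {ι : Type*} (s : Finset ι) {F : ι → (Fin n → ℝ) → ℝ}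
    (hF : ∀ a ∈ s, DifferentiableAt ℝ (F a) x) (i : Fin n) :
    pd i (fun y => ∑ a ∈ s, F a y) x = ∑ a ∈ s, pd i (F a) x := by
  rw [pd, fderiv_fun_sum hF]
  simp [pd]

end PartialDerivatives

section MatrixSmoothness

variable {n : ℕ} {U : Set (Fin n → ℝ)}

theorem contDiffOn_det {A : (Fin n → ℝ) → Matrix (Fin n) (Fin n) ℝ}
    (hA : ∀ a b, ContDiffOn ℝ (⊤ : ℕ∞) (fun x => A x a b) U) :
    ContDiffOn ℝ (⊤ : ℕ∞) (fun x => (A x).det) U := by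
  simp only [Matrix.det_apply]
  exact ContDiffOn.sum fun σ _ => (contDiffOn_prod fun i _ => hA _ _).const_smul _

theorem contDiffOn_inv_apply {A : (Fin n → ℝ) → Matrix (Fin n) (Fin n) ℝ}
    (hA : ∀ a b, ContDiffOn ℝ (⊤ : ℕ∞) (fun x => A x a b) U)
    (hdet : ∀ x ∈ U, IsUnit (A x).det) (a b : Fin n) :
    ContDiffOn ℝ (⊤ : ℕ∞) (fun x => (A x)⁻¹ a b) U := by
  simp only [Matrix.inv_def, Ring.inverse_eq_inv', Matrix.smul_apply, smul_eq_mul,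
    Matrix.adjugate_apply]
  refine ((contDiffOn_det hA).inv fun x hx => (hdet x hx).ne_zero).mul
    (contDiffOn_det fun c d => ?_)
  by_cases hc : c = b
  · simp only [hc, Matrix.updateRow_self]
    exact contDiffOn_const
  · simp only [Matrix.updateRow_ne hc]
    exact hA c d

end MatrixSmoothness

/-- The derivation action of an endomorphism on covariant tensors. -/
def derivAct {n s : ℕ} (A : Matrix (Fin n) (Fin n) ℝ) (T : (Fin s → Fin n) → ℝ) :
    (Fin s → Fin n) → ℝ :=
  fun idx => ∑ a, ∑ e, A e (idx a) * T (Function.update idx a e)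

section DerivAct

variable {n s : ℕ} (A B : Matrix (Fin n) (Fin n) ℝ) (T : (Fin s → Fin n) → ℝ)

theorem derivAct_add : derivAct (A + B) T = derivAct A T + derivAct B T := by
  ext idx
  simp [derivAct, add_mul, Finset.sum_add_distrib]

theorem derivAct_sub : derivAct (A - B) T = derivAct A T - derivAct B T := by
  ext idx
  simp [derivAct, sub_mul, Finset.sum_sub_distrib]

theorem derivAct_commutator :
    derivAct A (derivAct B T) - derivAct B (derivAct A T) = derivAct (B * A - A * B) T := by
  let F : Matrix (Fin n) (Fin n) ℝ → Matrix (Fin n) (Fin n) ℝ → (Fin s → Fin n) → Fin s →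
      Fin s → ℝ := fun A B idx a b => ∑ e, ∑ f, A e (idx a) *
        (B f (Function.update idx a e b) * T (Function.update (Function.update idx a e) b f))
  have hF : ∀ A B idx, derivAct A (derivAct B T) idx = ∑ a, ∑ b, F A B idx a b := by
    intro A B idx
    simp only [derivAct, F, Finset.mul_sum]
    exact Finset.sum_congr rfl fun a _ => Finset.sum_comm
  have hoff : ∀ idx a b, a ≠ b → F A B idx a b = F B A idx b a := by
    intro idx a b hab
    simp only [F]
    rw [Finset.sum_comm]
    refine Finset.sum_congr rfl fun f _ => Finset.sum_congr rfl fun e _ => ?_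
    rw [Function.update_of_ne hab.symm, Function.update_of_ne hab, Function.update_comm hab]
    ring
  have hdiag : ∀ A B idx a, F A B idx a a
      = ∑ f, (B * A) f (idx a) * T (Function.update idx a f) := by
    intro A B idx a
    simp only [F, Function.update_self, Function.update_idem]
    rw [Finset.sum_comm]
    refine Finset.sum_congr rfl fun f _ => ?_
    rw [Matrix.mul_apply, Finset.sum_mul]
    exact Finset.sum_congr rfl fun e _ => by ring
  ext idx
  rw [derivAct_sub, Pi.sub_apply, Pi.sub_apply, hF, hF, Finset.sum_comm (f := F B A idx),
    ← Finset.sum_sub_distrib]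
  simp only [derivAct]
  rw [← Finset.sum_sub_distrib]
  refine Finset.sum_congr rfl fun a _ => ?_
  rw [← Finset.sum_sub_distrib, Finset.sum_eq_single a, hdiag, hdiag]
  · intro b _ hb
    rw [hoff idx a b hb.symm, sub_self]
  · simp

end DerivAct

section Coordinates

variable {n : ℕ} {g : MetricMat n} {U : Set (Fin n → ℝ)}

/-- The connection matrix `(Γ_a)^e_k` in the coordinate direction `a`. -/
def connMatrix (g : MetricMat n) (x : Fin n → ℝ) (a : Fin n) : Matrix (Fin n) (Fin n) ℝ :=
  Matrix.of fun e k => christoffel g x e a k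

/-- The curvature endomorphism `(R_{ij})^l_k`. -/
def curvMatrix (g : MetricMat n) (x : Fin n → ℝ) (i j : Fin n) : Matrix (Fin n) (Fin n) ℝ :=
  Matrix.of fun l k => curvUp g x l k i j

theorem contDiffOn_christoffel (hU : IsOpen U)
    (hg : ∀ a b, ContDiffOn ℝ (⊤ : ℕ∞) (fun x => g x a b) U)
    (hdet : ∀ x ∈ U, IsUnit (g x).det) (k i j : Fin n) :
    ContDiffOn ℝ (⊤ : ℕ∞) (fun x => christoffel g x k i j) U :=
  contDiffOn_const.mul <| ContDiffOn.sum fun l _ => (contDiffOn_inv_apply hg hdet k l).mul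
    (((pd_contDiffOn hU (hg l j) i).add (pd_contDiffOn hU (hg l i) j)).sub
      (pd_contDiffOn hU (hg i j) l))

theorem contDiffOn_riemann (hU : IsOpen U)
    (hg : ∀ a b, ContDiffOn ℝ (⊤ : ℕ∞) (fun x => g x a b) U)
    (hdet : ∀ x ∈ U, IsUnit (g x).det) (idx : Fin 4 → Fin n) :
    ContDiffOn ℝ (⊤ : ℕ∞) (fun x => riemann g x idx) U := by
  have hΓ := contDiffOn_christoffel hU hg hdet
  refine ContDiffOn.sum fun m _ => (hg _ _).mul ?_
  exact (((pd_contDiffOn hU (hΓ _ _ _) _).sub (pd_contDiffOn hU (hΓ _ _ _) _)).add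
    (ContDiffOn.sum fun m _ => (hΓ _ _ _).mul (hΓ _ _ _))).sub
    (ContDiffOn.sum fun m _ => (hΓ _ _ _).mul (hΓ _ _ _))

/-- A parallel covariant tensor field is annihilated by the curvature endomorphisms. -/
theorem derivAct_curvMatrix_of_parallel {s : ℕ} {T : TensorField n s} (hU : IsOpen U)
    (hΓ : ∀ k i j, ContDiffOn ℝ (⊤ : ℕ∞) (fun x => christoffel g x k i j) U)
    (hT : ∀ idx, ContDiffOn ℝ (⊤ : ℕ∞) (fun x => T x idx) U)
    (hpar : ∀ x ∈ U, ∀ idx, covDeriv g T x idx = 0) {x : Fin n → ℝ} (hx : x ∈ U) (i j : Fin n) :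
    derivAct (curvMatrix g x i j) (T x) = 0 := by
  have hpd : ∀ a idx, ∀ y ∈ U,
      pd a (fun y => T y idx) y = derivAct (connMatrix g y a) (T y) idx := by
    intro a idx y hy
    have := hpar y hy (Fin.cons a idx)
    simp only [covDeriv, Fin.cons_zero, Fin.cons_succ] at this
    exact sub_eq_zero.mp this
  have hpd2 : ∀ a b idx, pd b (pd a fun y => T y idx) x
      = derivAct (Matrix.of fun e k => pd b (fun y => christoffel g y e a k) x) (T x) idx
        + derivAct (connMatrix g x a) (derivAct (connMatrix g x b) (T x)) idx := by
    intro a b idx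
    have hdΓ : ∀ k i j, DifferentiableAt ℝ (fun y => christoffel g y k i j) x := fun k i j =>
      differentiableAt_of_smoothOn hU (hΓ k i j) hx
    have hdT : ∀ idx, DifferentiableAt ℝ (fun y => T y idx) x := fun idx =>
      differentiableAt_of_smoothOn hU (hT idx) hx
    rw [pd_congr_of_eqOn hU (hpd a idx) hx]
    simp only [derivAct, connMatrix, Matrix.of_apply]
    rw [pd_sum _ fun c _ => DifferentiableAt.fun_sum fun e _ => (hdΓ _ _ _).fun_mul (hdT _),
      ← Finset.sum_add_distrib]
    refine Finset.sum_congr rfl fun c _ => ?_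
    rw [pd_sum _ fun e _ => (hdΓ _ _ _).fun_mul (hdT _), ← Finset.sum_add_distrib]
    refine Finset.sum_congr rfl fun e _ => ?_
    rw [pd_mul (hdΓ _ _ _) (hdT _), hpd b _ x hx]
    rfl
  have hcurv : curvMatrix g x i j
      = (Matrix.of fun e k => pd i (fun y => christoffel g y e j k) x)
        - (Matrix.of fun e k => pd j (fun y => christoffel g y e i k) x)
        + (connMatrix g x i * connMatrix g x j - connMatrix g x j * connMatrix g x i) := by
    ext l k
    simp only [curvMatrix, curvUp, connMatrix, Matrix.add_apply, Matrix.sub_apply,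
      Matrix.mul_apply, Matrix.of_apply]
    ring
  ext idx
  have hsymm := pd_comm hU (hT idx) hx i j
  rw [hpd2, hpd2] at hsymm
  rw [hcurv, derivAct_add, derivAct_sub, ← derivAct_commutator]
  simp only [Pi.add_apply, Pi.sub_apply, Pi.zero_apply]
  linarith

theorem christoffel_symm (hU : IsOpen U) (hsymm : ∀ x ∈ U, (g x).IsSymm) {x : Fin n → ℝ}
    (hx : x ∈ U) (k i j : Fin n) : christoffel g x k i j = christoffel g x k j i := by
  simp only [christoffel]
  congr 1
  refine Finset.sum_congr rfl fun l _ => ?_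
  rw [pd_congr_of_eqOn hU (fun y hy => (hsymm y hy).apply j i : Set.EqOn (fun y => g y i j) _ U) hx]
  ring

theorem sum_metric_mul_christoffel {x : Fin n → ℝ} (hdet : IsUnit (g x).det) (l i j : Fin n) :
    ∑ e, g x l e * christoffel g x e i j = (1 / 2) *
      (pd i (fun y => g y l j) x + pd j (fun y => g y l i) x - pd l (fun y => g y i j) x) := by
  have hinv := Matrix.mul_nonsing_inv (g x) hdet
  let D : Fin n → ℝ := fun l =>
    pd i (fun y => g y l j) x + pd j (fun y => g y l i) x - pd l (fun y => g y i j) x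
  have hΓ : (fun e => christoffel g x e i j) = (1 / 2 : ℝ) • ((g x)⁻¹ *ᵥ D) := rfl
  calc ∑ e, g x l e * christoffel g x e i j
      = (g x *ᵥ fun e => christoffel g x e i j) l := rfl
    _ = (1 / 2) * D l := by
      rw [hΓ, Matrix.mulVec_smul, Matrix.mulVec_mulVec, hinv, Matrix.one_mulVec]; rfl

/-- The metric is parallel for its Levi-Civita connection. -/
theorem covDeriv_metric_eq_zero (hU : IsOpen U) (hsymm : ∀ x ∈ U, (g x).IsSymm)
    (hdet : ∀ x ∈ U, IsUnit (g x).det) {x : Fin n → ℝ} (hx : x ∈ U) (idx : Fin 3 → Fin n) :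
    covDeriv (s := 2) g (fun y idx => g y (idx 0) (idx 1)) x idx = 0 := by
  have hpd : ∀ a k l, pd a (fun y => g y k l) x = pd a (fun y => g y l k) x := fun a k l =>
    pd_congr_of_eqOn hU (fun y hy => (hsymm y hy).apply l k) hx a
  have h1 := sum_metric_mul_christoffel (hdet x hx) (idx 2) (idx 0) (idx 1)
  have h2 := sum_metric_mul_christoffel (hdet x hx) (idx 1) (idx 0) (idx 2)
  have h3 : ∀ e, g x e (idx 2) = g x (idx 2) e := fun e => (hsymm x hx).apply _ _
  have h4 : (1 : Fin 2).succ = (2 : Fin 3) := rfl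
  have h5 : (0 : Fin 2).succ = (1 : Fin 3) := rfl
  simp only [covDeriv, Fin.sum_univ_two, Function.update_self, h4, h5, ne_eq,
    Fin.zero_ne_one, one_ne_zero, not_false_eq_true, Function.update_of_ne, h3]
  simp only [mul_comm (christoffel _ _ _ _ _)]
  rw [h1, h2, hpd _ (idx 2) (idx 1), hpd (idx 2) (idx 1) (idx 0), hpd (idx 1) (idx 2) (idx 0)]
  ring

theorem curvMatrix_antisymm (x : Fin n → ℝ) (i j : Fin n) :
    curvMatrix g x i j = -curvMatrix g x j i := by
  ext l k
  simp only [curvMatrix, curvUp, Matrix.of_apply, Matrix.neg_apply]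
  ring

theorem curvUp_bianchi (hU : IsOpen U) (hsymm : ∀ x ∈ U, (g x).IsSymm) {x : Fin n → ℝ}
    (hx : x ∈ U) (l i j k : Fin n) :
    curvUp g x l k i j + curvUp g x l i j k + curvUp g x l j k i = 0 := by
  have hpd : ∀ a k i j, pd a (fun y => christoffel g y k i j) x
      = pd a (fun y => christoffel g y k j i) x := fun a k i j =>
    pd_congr_of_eqOn hU (fun y hy => christoffel_symm hU hsymm hy k i j) hx a
  simp only [curvUp]
  rw [hpd k l i j, hpd j l i k, hpd i l j k]
  simp only [christoffel_symm hU hsymm hx _ i j, christoffel_symm hU hsymm hx _ i k,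
    christoffel_symm hU hsymm hx _ j k]
  ring

theorem curvMatrix_skew (hU : IsOpen U) (hg : ∀ a b, ContDiffOn ℝ (⊤ : ℕ∞) (fun x => g x a b) U)
    (hsymm : ∀ x ∈ U, (g x).IsSymm) (hdet : ∀ x ∈ U, IsUnit (g x).det) {x : Fin n → ℝ}
    (hx : x ∈ U) (i j : Fin n) : (curvMatrix g x i j)ᵀ * g x = -(g x * curvMatrix g x i j) := by
  have h := derivAct_curvMatrix_of_parallel (T := fun y (idx : Fin 2 → Fin n) =>
    g y (idx 0) (idx 1)) hU (contDiffOn_christoffel hU hg hdet) (fun _ => hg _ _)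
    (fun y hy idx => covDeriv_metric_eq_zero hU hsymm hdet hy idx) hx i j
  ext k l
  have hkl := congrFun h ![k, l]
  simp only [derivAct, Fin.sum_univ_two, Function.update_self, ne_eq, Fin.zero_ne_one,
    one_ne_zero, not_false_eq_true, Function.update_of_ne, Matrix.cons_val_zero,
    Matrix.cons_val_one, Pi.zero_apply] at hkl
  rw [Matrix.neg_apply, Matrix.mul_apply, Matrix.mul_apply, eq_neg_iff_add_eq_zero, ← hkl]
  simp only [Matrix.transpose_apply, mul_comm (g x k _)]

theorem curvMatrix_commutator (hU : IsOpen U)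
    (hg : ∀ a b, ContDiffOn ℝ (⊤ : ℕ∞) (fun x => g x a b) U)
    (hsymm : ∀ x ∈ U, (g x).IsSymm) (hdet : ∀ x ∈ U, IsUnit (g x).det)
    (hpar : RthSymmetricOn g U 1) {x : Fin n → ℝ} (hx : x ∈ U) (i j p q : Fin n) :
    curvMatrix g x i j * curvMatrix g x p q - curvMatrix g x p q * curvMatrix g x i j
      = ∑ e, (curvMatrix g x i j e p • curvMatrix g x e q
          + curvMatrix g x i j e q • curvMatrix g x p e) := by
  have h := derivAct_curvMatrix_of_parallel (T := riemann g) hU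
    (contDiffOn_christoffel hU hg hdet) (contDiffOn_riemann hU hg hdet) hpar hx i j
  have hskew := curvMatrix_skew hU hg hsymm hdet hx i j
  set A := curvMatrix g x i j
  have hriem : ∀ idx, riemann g x idx
      = (g x * curvMatrix g x (idx 2) (idx 3)) (idx 0) (idx 1) := fun _ => rfl
  have key : Aᵀ * (g x * curvMatrix g x p q) + g x * curvMatrix g x p q * A
      + g x * ∑ e, (A e p • curvMatrix g x e q + A e q • curvMatrix g x p e) = 0 := by
    ext l k
    have hlk := congrFun h ![l, k, p, q]
    simp only [derivAct, Fin.sum_univ_four, hriem, Pi.zero_apply] at hlk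
    simp [Function.update] at hlk
    rw [Matrix.zero_apply, ← hlk]
    simp only [Matrix.mul_sum, Matrix.mul_add, Matrix.mul_smul, Matrix.add_apply,
      Matrix.sum_apply, Matrix.smul_apply, smul_eq_mul, Finset.sum_add_distrib,
      Matrix.mul_apply (M := Aᵀ), Matrix.mul_apply (N := A), Matrix.transpose_apply]
    simp only [mul_comm _ (A _ k)]
    ring
  rw [← mul_assoc, hskew] at key
  have hg0 : g x * (-(A * curvMatrix g x p q) + curvMatrix g x p q * A
      + ∑ e, (A e p • curvMatrix g x e q + A e q • curvMatrix g x p e)) = 0 := by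
    rw [← key]; noncomm_ring
  have := congrArg ((g x)⁻¹ * ·) hg0
  simp only [← mul_assoc, Matrix.nonsing_inv_mul _ (hdet x hx), one_mul, mul_zero] at this
  rw [← sub_eq_zero, ← neg_eq_zero, ← this]
  abel

theorem linear_induction_on_single {P : (Fin n → ℝ) → Prop} (zero : P 0)
    (add : ∀ u w, P u → P w → P (u + w)) (smul : ∀ (c : ℝ) u, P u → P (c • u))
    (single : ∀ i, P (Pi.single i 1)) (u : Fin n → ℝ) : P u := by
  have hu : u ∈ Submodule.span ℝ (Set.range (Pi.basisFun ℝ (Fin n))) := by simp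
  induction hu using Submodule.span_induction with
  | mem w hw => obtain ⟨i, rfl⟩ := hw; simpa using single i
  | zero => exact zero
  | add u w _ _ hu hw => exact add u w hu hw
  | smul c u _ hu => exact smul c u hu

/-- The curvature endomorphism `R(u, w)` of the tangent space. -/
def curvEnd (g : MetricMat n) (x : Fin n → ℝ) :
    (Fin n → ℝ) →ₗ[ℝ] (Fin n → ℝ) →ₗ[ℝ] Module.End ℝ (Fin n → ℝ) :=
  LinearMap.mk₂ ℝ (fun u w => ∑ i, ∑ j, (u i * w j) • Matrix.toLin' (curvMatrix g x i j))
    (fun _ _ _ => by simp only [Pi.add_apply, add_mul, add_smul, Finset.sum_add_distrib])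
    (fun _ _ _ => by simp only [Pi.smul_apply, smul_eq_mul, mul_assoc, mul_smul, Finset.smul_sum])
    (fun _ _ _ => by simp only [Pi.add_apply, mul_add, add_smul, Finset.sum_add_distrib])
    (fun _ _ _ => by
      simp only [Pi.smul_apply, smul_eq_mul, mul_left_comm, mul_smul, Finset.smul_sum])

theorem curvEnd_single_right (x u : Fin n → ℝ) (q : Fin n) :
    curvEnd g x u (Pi.single q 1) = ∑ e, u e • Matrix.toLin' (curvMatrix g x e q) := by
  simp [curvEnd, Pi.single_apply]

theorem curvEnd_single_left (x u : Fin n → ℝ) (p : Fin n) :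
    curvEnd g x (Pi.single p 1) u = ∑ e, u e • Matrix.toLin' (curvMatrix g x p e) := by
  simp [curvEnd, Pi.single_apply]

theorem curvEnd_single (x : Fin n → ℝ) (i j : Fin n) :
    curvEnd g x (Pi.single i 1) (Pi.single j 1) = Matrix.toLin' (curvMatrix g x i j) := by
  simp [curvEnd, Pi.single_apply]

theorem curvEnd_antisymm (x u w : Fin n → ℝ) : curvEnd g x u w = -curvEnd g x w u := by
  simp only [curvEnd, LinearMap.mk₂_apply]
  rw [Finset.sum_comm, ← Finset.sum_neg_distrib]
  refine Finset.sum_congr rfl fun i _ => ?_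
  rw [← Finset.sum_neg_distrib]
  refine Finset.sum_congr rfl fun j _ => ?_
  rw [curvMatrix_antisymm x j i, map_neg, smul_neg, mul_comm]

theorem curvEnd_bianchi (hU : IsOpen U) (hsymm : ∀ x ∈ U, (g x).IsSymm) {x : Fin n → ℝ}
    (hx : x ∈ U) (u v w : Fin n → ℝ) :
    curvEnd g x u v w + curvEnd g x v w u + curvEnd g x w u v = 0 := by
  induction u using linear_induction_on_single with
  | zero => simp
  | add a b ha hb =>
    simp only [map_add, LinearMap.add_apply]
    linear_combination (norm := module) ha + hb
  | smul c a ha =>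
    simp only [map_smul, LinearMap.smul_apply]
    linear_combination (norm := module) c • ha
  | single i =>
  induction v using linear_induction_on_single with
  | zero => simp
  | add a b ha hb =>
    simp only [map_add, LinearMap.add_apply]
    linear_combination (norm := module) ha + hb
  | smul c a ha =>
    simp only [map_smul, LinearMap.smul_apply]
    linear_combination (norm := module) c • ha
  | single j =>
  induction w using linear_induction_on_single with
  | zero => simp
  | add a b ha hb =>
    simp only [map_add, LinearMap.add_apply]
    linear_combination (norm := module) ha + hb
  | smul c a ha =>
    simp only [map_smul, LinearMap.smul_apply]
    linear_combination (norm := module) c • ha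
  | single k =>
    ext l
    simpa [curvEnd_single, curvMatrix] using curvUp_bianchi hU hsymm hx l i j k

theorem curvEnd_skew (hU : IsOpen U) (hg : ∀ a b, ContDiffOn ℝ (⊤ : ℕ∞) (fun x => g x a b) U)
    (hsymm : ∀ x ∈ U, (g x).IsSymm) (hdet : ∀ x ∈ U, IsUnit (g x).det) {x : Fin n → ℝ}
    (hx : x ∈ U) (u v z w : Fin n → ℝ) :
    Matrix.toBilin' (g x) (curvEnd g x u v z) w = -Matrix.toBilin' (g x) z (curvEnd g x u v w) := by
  induction u using linear_induction_on_single with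
  | zero => simp
  | add a b ha hb => simp [ha, hb]; ring
  | smul c a ha => simp [ha]
  | single i =>
  induction v using linear_induction_on_single with
  | zero => simp
  | add a b ha hb => simp [ha, hb]; ring
  | smul c a ha => simp [ha]
  | single j =>
    rw [curvEnd_single, Matrix.toBilin'_apply', Matrix.toBilin'_apply', Matrix.toLin'_apply,
      Matrix.toLin'_apply, Matrix.mulVec_mulVec, ← dotProduct_neg, ← Matrix.neg_mulVec,
      ← curvMatrix_skew hU hg hsymm hdet hx, ← Matrix.mulVec_mulVec, Matrix.dotProduct_mulVec z,
      Matrix.vecMul_transpose]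

theorem curvEnd_commutator (hU : IsOpen U)
    (hg : ∀ a b, ContDiffOn ℝ (⊤ : ℕ∞) (fun x => g x a b) U)
    (hsymm : ∀ x ∈ U, (g x).IsSymm) (hdet : ∀ x ∈ U, IsUnit (g x).det)
    (hpar : RthSymmetricOn g U 1) {x : Fin n → ℝ} (hx : x ∈ U) (u v w z : Fin n → ℝ) :
    curvEnd g x u v * curvEnd g x w z - curvEnd g x w z * curvEnd g x u v
      = curvEnd g x (curvEnd g x u v w) z + curvEnd g x w (curvEnd g x u v z) := by
  induction u using linear_induction_on_single with
  | zero => simp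
  | add a b ha hb =>
    simp only [map_add, LinearMap.add_apply, add_mul, mul_add]
    linear_combination (norm := module) ha + hb
  | smul c a ha =>
    simp only [map_smul, LinearMap.smul_apply, smul_mul_assoc, mul_smul_comm]
    linear_combination (norm := module) c • ha
  | single i =>
  induction v using linear_induction_on_single with
  | zero => simp
  | add a b ha hb =>
    simp only [map_add, LinearMap.add_apply, add_mul, mul_add]
    linear_combination (norm := module) ha + hb
  | smul c a ha =>
    simp only [map_smul, LinearMap.smul_apply, smul_mul_assoc, mul_smul_comm]
    linear_combination (norm := module) c • ha
  | single j =>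
  induction w using linear_induction_on_single with
  | zero => simp
  | add a b ha hb =>
    simp only [map_add, LinearMap.add_apply, add_mul, mul_add]
    linear_combination (norm := module) ha + hb
  | smul c a ha =>
    simp only [map_smul, LinearMap.smul_apply, smul_mul_assoc, mul_smul_comm]
    linear_combination (norm := module) c • ha
  | single p =>
  induction z using linear_induction_on_single with
  | zero => simp
  | add a b ha hb =>
    simp only [map_add, add_mul, mul_add]
    linear_combination (norm := module) ha + hb
  | smul c a ha =>
    simp only [map_smul, smul_mul_assoc, mul_smul_comm]
    linear_combination (norm := module) c • ha
  | single q =>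
    rw [curvEnd_single, curvEnd_single, curvEnd_single_right, curvEnd_single_left,
      ← Finset.sum_add_distrib]
    have h := congrArg Matrix.toLin' (curvMatrix_commutator hU hg hsymm hdet hpar hx i j p q)
    simpa [Matrix.toLin'_mul, Module.End.mul_eq_comp] using h

theorem trace_curvEnd_flip {x : Fin n → ℝ} (hric : ∀ i j, ricci g x i j = 0)
    (u w : Fin n → ℝ) : LinearMap.trace ℝ (Fin n → ℝ) ((curvEnd g x u).flip w) = 0 := by
  rw [LinearMap.trace_eq_matrix_trace ℝ (Pi.basisFun ℝ (Fin n)), Matrix.trace]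
  simp only [Matrix.diag_apply, LinearMap.toMatrix_apply, Pi.basisFun_apply, Pi.basisFun_repr,
    LinearMap.flip_apply]
  induction u using linear_induction_on_single with
  | zero => simp
  | add a b ha hb => simp [Finset.sum_add_distrib, ha, hb]
  | smul c a ha => simp [← Finset.mul_sum, ha]
  | single j =>
  induction w using linear_induction_on_single with
  | zero => simp
  | add a b ha hb => simp [Finset.sum_add_distrib, ha, hb]
  | smul c a ha => simp only [map_smul, Pi.smul_apply, ← Finset.smul_sum, ha, smul_zero]
  | single i =>
    rw [← neg_eq_zero, ← hric i j, ricci, ← Finset.sum_neg_distrib]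
    refine Finset.sum_congr rfl fun m _ => ?_
    rw [curvEnd_single, curvMatrix_antisymm]
    simp [curvMatrix]

end Coordinates

theorem flatOn_of_rthSymmetricOn_one_of_ricci_eq_zero {n : ℕ} {g : MetricMat n}
    {U : Set (Fin n → ℝ)} (hU : IsOpen U)
    (hg : ∀ a b, ContDiffOn ℝ (⊤ : ℕ∞) (fun x => g x a b) U)
    (hpos : ∀ x ∈ U, (g x).PosDef) (hpar : RthSymmetricOn g U 1)
    (hric : ∀ x ∈ U, ∀ i j, ricci g x i j = 0) : FlatOn g U := by
  have hdet : ∀ x ∈ U, IsUnit (g x).det := fun x hx => (hpos x hx).det_pos.ne'.isUnit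
  have hsymm : ∀ x ∈ U, (g x).IsSymm := fun x hx => by
    simpa [Matrix.IsHermitian, Matrix.IsSymm] using (hpos x hx).isHermitian
  intro x hx idx
  have hzero := curvature_eq_zero_of_semisymmetric (Matrix.toBilin' (g x))
    (Matrix.isSymm_toBilin'_iff_isSymm.mpr (hsymm x hx))
    (fun v hv => by
      simpa [Matrix.toBilin'_apply'] using (hpos x hx).dotProduct_mulVec_pos hv)
    (curvEnd g x) (curvEnd_antisymm x) (curvEnd_skew hU hg hsymm hdet hx)
    (curvEnd_bianchi hU hsymm hx) (curvEnd_commutator hU hg hsymm hdet hpar hx)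
    (trace_curvEnd_flip (hric x hx)) (Pi.single (idx 2) 1) (Pi.single (idx 3) 1)
  rw [curvEnd_single, LinearEquiv.map_eq_zero_iff] at hzero
  exact Finset.sum_eq_zero fun m _ => mul_eq_zero_of_right _ (congrFun₂ hzero m (idx 1))

/-!
## STATEMENT 5
A locally symmetric (`∇R = 0`) Riemannian manifold whose Ricci tensor vanishes
identically is flat: its full Riemann curvature tensor vanishes.
-/
theorem locally_symmetric_ricci_flat_is_flat
    {m : ℕ} (Y : PRManifold m)
    (hriem : Y.IsRiemannian) (hls : Y.RthSymmetric 1) (hric : Y.RicciFlat) :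
    Y.Flat := by
  exact fun p => flatOn_of_rthSymmetricOn_one_of_ricci_eq_zero (Y.chartAt p).open_ran
    (Y.chartAt p).smooth_g (hriem p) (hls p) (hric p)
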